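/- Let G be a finite simple graph with at least one edge, with no K_6-minor, and such that every edge incident to a vertex of degree at most 7 belongs to at least 4 triangles. Then for every vertex u of degree at most 7 and every connected component C of G \ N[u], there exists a vertex of C whose degree in G is at most 7. -/

import Mathlib

open SimpleGraph

/-- `H` is a minor of `G`: there is a family of nonempty, pairwise disjoint,
connected branch sets in `G`, one for each vertex of `H`, with an edge of `G`
between the branch sets corresponding to each edge of `H`. -/
def SimpleGraph.MinorOf {W V : Type} (H : SimpleGraph W) (G : SimpleGraph V) : Prop :=
  ∃ f : W → Set V,
    (∀ w, (f w).Nonempty) ∧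
    (∀ w, (G.induce (f w)).Connected) ∧
    (∀ w₁ w₂, w₁ ≠ w₂ → Disjoint (f w₁) (f w₂)) ∧
    (∀ w₁ w₂, H.Adj w₁ w₂ → ∃ v₁ ∈ f w₁, ∃ v₂ ∈ f w₂, G.Adj v₁ v₂)

namespace SimpleGraph

section

variable {V : Type}

/-- `S` is nonempty and no proper nonempty part of it is closed under adjacency within `S`. -/
def ConnectedOn (G : SimpleGraph V) (S : Set V) : Prop :=
  S.Nonempty ∧ ∀ A ⊆ S, A.Nonempty → (∀ a ∈ A, ∀ b ∈ S, G.Adj a b → b ∈ A) → S ⊆ A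

theorem connected_induce_iff_connectedOn {G : SimpleGraph V} {S : Set V} :
    (G.induce S).Connected ↔ G.ConnectedOn S := by
  constructor
  · intro h
    refine ⟨Set.nonempty_coe_sort.1 h.nonempty, ?_⟩
    rintro A hAS ⟨a, ha⟩ hcl b hb
    have key : ∀ x y : S, (G.induce S).Walk x y → (x : V) ∈ A → (y : V) ∈ A := by
      intro x y p
      induction p with
      | nil => exact id
      | cons hadj _ ih => exact fun hx => ih (hcl _ hx _ (Subtype.property _) hadj)
    obtain ⟨p⟩ := h.preconnected ⟨a, hAS ha⟩ ⟨b, hb⟩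
    exact key _ _ p ha
  · rintro ⟨⟨c, hc⟩, h⟩
    rw [connected_iff]
    refine ⟨?_, ⟨⟨c, hc⟩⟩⟩
    rintro ⟨a, ha⟩ ⟨b, hb⟩
    have := h {x | ∃ hx : x ∈ S, (G.induce S).Reachable ⟨a, ha⟩ ⟨x, hx⟩}
      (fun x hx => hx.1) ⟨a, ha, Reachable.refl _⟩
      (fun x ⟨hx, hr⟩ y hy hxy => ⟨hy, hr.trans (Adj.reachable (by simpa using hxy))⟩) hb
    exact this.2

theorem connectedOn_singleton (G : SimpleGraph V) (v : V) : G.ConnectedOn {v} := by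
  refine ⟨⟨v, rfl⟩, fun A hA ⟨a, ha⟩ _ => ?_⟩
  rw [Set.singleton_subset_iff]
  exact (hA ha) ▸ ha

theorem ConnectedOn.insert {G : SimpleGraph V} {S : Set V} {x c : V} (hS : G.ConnectedOn S)
    (hc : c ∈ S) (hxc : G.Adj x c) : G.ConnectedOn (insert x S) := by
  refine ⟨⟨x, Or.inl rfl⟩, fun A hA ⟨a, ha⟩ hcl => ?_⟩
  have hA' : (A ∩ S).Nonempty := by
    rcases hA ha with rfl | h
    · exact ⟨c, hcl _ ha _ (Or.inr hc) hxc, hc⟩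
    · exact ⟨a, ha, h⟩
  have hSA : S ⊆ A := fun s hs => (hS.2 (A ∩ S) Set.inter_subset_right hA'
    (fun a ha b hb hab => ⟨hcl a ha.1 b (Or.inr hb) hab, hb⟩) hs).1
  exact Set.insert_subset (hcl c (hSA hc) x (Or.inl rfl) hxc.symm) hSA

theorem ConnectedOn.biUnion {G G' : SimpleGraph V} {S : Set V} {B : V → Set V}
    (hS : G'.ConnectedOn S) (hB : ∀ v ∈ S, G.ConnectedOn (B v))
    (hadj : ∀ a ∈ S, ∀ b ∈ S, G'.Adj a b → ∃ x ∈ B a, ∃ y ∈ B b, G.Adj x y) :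
    G.ConnectedOn (⋃ v ∈ S, B v) := by
  constructor
  · obtain ⟨s, hs⟩ := hS.1
    obtain ⟨x, hx⟩ := (hB s hs).1
    exact ⟨x, Set.mem_biUnion hs hx⟩
  · rintro A hA ⟨a, ha⟩ hcl
    have hBA : ∀ v ∈ S, (A ∩ B v).Nonempty → B v ⊆ A := fun v hv hne b hb =>
      ((hB v hv).2 (A ∩ B v) Set.inter_subset_right hne
        (fun c hc d hd hcd => ⟨hcl c hc.1 d (Set.mem_biUnion hv hd) hcd, hd⟩) hb).1
    have hall : S ⊆ {v | v ∈ S ∧ B v ⊆ A} := by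
      apply hS.2 _ (fun v hv => hv.1)
      · obtain ⟨v, hv, hav⟩ := Set.mem_iUnion₂.1 (hA ha)
        exact ⟨v, hv, hBA v hv ⟨a, ha, hav⟩⟩
      · rintro v ⟨hv, hvA⟩ w hw hvw
        obtain ⟨x, hx, y, hy, hxy⟩ := hadj v hv w hw hvw
        exact ⟨hw, hBA w hw ⟨y, hcl x (hvA hx) y (Set.mem_biUnion hw hy) hxy, hy⟩⟩
    exact Set.iUnion₂_subset fun v hv => (hall hv).2

/-- `G` has `r` disjoint connected vertex sets, any two of them joined by an edge. -/
def HasCompleteMinor (r : ℕ) (G : SimpleGraph V) : Prop :=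
  ∃ f : Fin r → Set V, (∀ i, G.ConnectedOn (f i)) ∧ (∀ i j, i ≠ j → Disjoint (f i) (f j)) ∧
    ∀ i j, i ≠ j → ∃ x ∈ f i, ∃ y ∈ f j, G.Adj x y

theorem connectedOn_subset_support {G : SimpleGraph V} {S : Set V} (hS : G.ConnectedOn S)
    {a : V} (ha : a ∈ S) (hsupp : a ∈ G.support) : S ⊆ G.support := by
  by_contra hcon
  obtain ⟨b, hb, hbs⟩ := Set.not_subset.1 hcon
  have := hS.2 {b} (by simpa using hb) ⟨b, rfl⟩
    (by rintro _ rfl c _ hc; exact absurd ⟨c, hc⟩ hbs) ha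
  rw [Set.mem_singleton_iff] at this
  exact hbs (this ▸ hsupp)

/-- Substituting connected sets for the vertices of a graph preserves complete minors. -/
theorem HasCompleteMinor.trans {r : ℕ} {G G' : SimpleGraph V}
    (h : HasCompleteMinor (r + 2) G') (B : V → Set V)
    (hB : ∀ v ∈ G'.support, G.ConnectedOn (B v))
    (hdisj : ∀ v ∈ G'.support, ∀ w ∈ G'.support, v ≠ w → Disjoint (B v) (B w))
    (hadj : ∀ a b, G'.Adj a b → ∃ x ∈ B a, ∃ y ∈ B b, G.Adj x y) :
    HasCompleteMinor (r + 2) G := by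
  obtain ⟨f, hc, hd, ha⟩ := h
  have hsupp : ∀ i, f i ⊆ G'.support := by
    intro i
    obtain ⟨j, hj⟩ := exists_ne i
    obtain ⟨x, hx, y, _, hxy⟩ := ha i j hj.symm
    exact connectedOn_subset_support (hc i) hx ⟨y, hxy⟩
  refine ⟨fun i => ⋃ v ∈ f i, B v, fun i => ?_, fun i j hij => ?_, fun i j hij => ?_⟩
  · exact (hc i).biUnion (fun v hv => hB v (hsupp i hv)) (fun a _ b _ => hadj a b)
  · simp only [Set.disjoint_iUnion_left, Set.disjoint_iUnion_right]
    intro v hv w hw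
    exact hdisj w (hsupp i hw) v (hsupp j hv)
      (fun e => Set.disjoint_left.1 (hd i j hij) hw (e ▸ hv))
  · obtain ⟨x, hx, y, hy, hxy⟩ := ha i j hij
    obtain ⟨p, hp, q, hq, hpq⟩ := hadj x y hxy
    exact ⟨p, Set.mem_biUnion hx hp, q, Set.mem_biUnion hy hq, hpq⟩

theorem HasCompleteMinor.mono {r : ℕ} {G G' : SimpleGraph V}
    (h : HasCompleteMinor (r + 2) G') (hle : G' ≤ G) : HasCompleteMinor (r + 2) G :=
  h.trans (fun v => {v}) (fun v _ => connectedOn_singleton G v) (by simp)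
    (fun a b hab => ⟨a, rfl, b, rfl, hle hab⟩)

theorem HasCompleteMinor.cone {r : ℕ} {G H : SimpleGraph V} {u : V}
    (h : HasCompleteMinor (r + 2) H) (hle : H ≤ G) (hu : u ∉ H.support)
    (hadj : ∀ v ∈ H.support, G.Adj u v) : HasCompleteMinor (r + 3) G := by
  obtain ⟨f, hc, hd, ha⟩ := h
  have hsupp : ∀ i, f i ⊆ H.support := by
    intro i
    obtain ⟨j, hj⟩ := exists_ne i
    obtain ⟨x, hx, y, _, hxy⟩ := ha i j hj.symm
    exact connectedOn_subset_support (hc i) hx ⟨y, hxy⟩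
  have hc' : ∀ i, G.ConnectedOn (f i) := fun i =>
    ⟨(hc i).1, fun A hA hne hcl => (hc i).2 A hA hne fun a ha b hb hab => hcl a ha b hb (hle hab)⟩
  have hu' : ∀ i, u ∉ f i := fun i hi => hu (hsupp i hi)
  have hex : ∀ i, ∃ y ∈ f i, G.Adj u y := fun i => by
    obtain ⟨y, hy⟩ := (hc i).1
    exact ⟨y, hy, hadj y (hsupp i hy)⟩
  refine ⟨Fin.cons {u} f, ?_, ?_, ?_⟩
  · exact Fin.cases (connectedOn_singleton G u) hc'
  · refine Fin.cases (Fin.cases (by simp) fun j _ => ?_) fun i => Fin.cases (fun _ => ?_) ?_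
    · simpa using hu' j
    · simpa using hu' i
    · intro j hij
      simpa using hd i j (by simpa using hij)
  · refine Fin.cases (Fin.cases (by simp) fun j _ => ?_) fun i => Fin.cases (fun _ => ?_) ?_
    · simpa using hex j
    · obtain ⟨y, hy, huy⟩ := hex i
      exact ⟨y, by simpa using hy, u, by simp, huy.symm⟩
    · intro j hij
      obtain ⟨x, hx, y, hy, hxy⟩ := ha i j (by simpa using hij)
      exact ⟨x, by simpa using hx, y, by simpa using hy, hle hxy⟩

theorem hasCompleteMinor_two {G : SimpleGraph V} {a b : V} (h : G.Adj a b) :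
    HasCompleteMinor 2 G := by
  have hne := h.ne
  refine ⟨![{a}, {b}], ?_, ?_, ?_⟩
  · intro i
    fin_cases i <;> exact connectedOn_singleton G _
  · intro i j hij
    fin_cases i <;> fin_cases j <;> simp_all [eq_comm]
  · intro i j hij
    fin_cases i <;> fin_cases j <;> simp_all [adj_comm]

/-- The edges of `G` with both ends in `A`. -/
def restrictTo (G : SimpleGraph V) (A : Set V) : SimpleGraph V where
  Adj a b := G.Adj a b ∧ a ∈ A ∧ b ∈ A
  symm.symm _ _ h := ⟨h.1.symm, h.2.2, h.2.1⟩
  loopless.irrefl _ h := h.1.ne rfl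

theorem restrictTo_le (G : SimpleGraph V) (A : Set V) : G.restrictTo A ≤ G := fun _ _ h => h.1

theorem support_restrictTo_subset (G : SimpleGraph V) (A : Set V) :
    (G.restrictTo A).support ⊆ A := fun _ ⟨_, h⟩ => h.2.1

theorem neighborSet_restrictTo {G : SimpleGraph V} {A : Set V} {v : V} (hv : v ∈ A) :
    (G.restrictTo A).neighborSet v = G.neighborSet v ∩ A := by
  ext w
  simp [restrictTo, hv]

end

section

variable {V : Type}

theorem exists_le_ncard_edgeSet_eq {G : SimpleGraph V} {m : ℕ} (h : m ≤ G.edgeSet.ncard) :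
    ∃ G' ≤ G, G'.edgeSet.ncard = m := by
  obtain ⟨s, hs, rfl⟩ := Set.exists_subset_card_eq h
  refine ⟨fromEdgeSet s, ?_, ?_⟩
  · intro a b hab
    rw [fromEdgeSet_adj] at hab
    exact hs hab.1
  · rw [edgeSet_fromEdgeSet, sdiff_eq_left.2]
    exact Set.disjoint_left.2 fun e he hd => G.not_isDiag_of_mem_edgeSet (hs he) hd

/-- Contraction of the edge `uv` onto `u`; the vertex `v` becomes isolated. -/
def contractEdge (G : SimpleGraph V) (u v : V) : SimpleGraph V :=
  G.deleteIncidenceSet v ⊔ fromEdgeSet ((fun b => s(u, b)) '' (G.neighborSet v \ {u}))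

theorem contractEdge_adj {G : SimpleGraph V} {u v a b : V} : (G.contractEdge u v).Adj a b ↔
    (G.Adj a b ∧ a ≠ v ∧ b ≠ v) ∨
      (a = u ∧ G.Adj v b ∧ b ≠ u) ∨ (b = u ∧ G.Adj v a ∧ a ≠ u) := by
  simp only [contractEdge, sup_adj, deleteIncidenceSet_adj, fromEdgeSet_adj, Set.mem_image,
    Set.mem_sdiff, mem_neighborSet, Set.mem_singleton_iff, Sym2.eq_iff]
  grind

theorem support_contractEdge_subset {G : SimpleGraph V} {u v : V} (h : G.Adj u v) {A : Set V}
    (hA : G.support ⊆ A) : (G.contractEdge u v).support ⊆ A \ {v} := by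
  rintro a ⟨b, hab⟩
  replace hab := contractEdge_adj.1 hab
  rcases hab with ⟨h1, h2, -⟩ | ⟨rfl, -, -⟩ | ⟨-, h1, -⟩
  · exact ⟨hA ⟨b, h1⟩, h2⟩
  · exact ⟨hA ⟨v, h⟩, h.ne⟩
  · exact ⟨hA ⟨v, h1.symm⟩, h1.ne'⟩

theorem HasCompleteMinor.of_contractEdge {G : SimpleGraph V} {u v : V} (h : G.Adj u v) {r : ℕ}
    (hm : HasCompleteMinor (r + 2) (G.contractEdge u v)) : HasCompleteMinor (r + 2) G := by
  classical
  have hv : ∀ w ∈ (G.contractEdge u v).support, w ≠ v := fun w hw =>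
    (support_contractEdge_subset h subset_rfl hw).2
  refine hm.trans (fun w => if w = u then {u, v} else {w}) ?_ ?_ ?_
  · intro w _
    split_ifs
    · exact (connectedOn_singleton G v).insert rfl h
    · exact connectedOn_singleton G w
  · intro a ha b hb hab
    have := hv a ha
    have := hv b hb
    split_ifs <;> simp_all [eq_comm]
  · intro a b hab
    have hmem : ∀ w, w ∈ (if w = u then ({u, v} : Set V) else {w}) := fun w => by
      split_ifs <;> simp_all
    rw [contractEdge_adj] at hab
    rcases hab with ⟨h1, -, -⟩ | ⟨rfl, h1, -⟩ | ⟨rfl, h1, -⟩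
    · exact ⟨a, hmem a, b, hmem b, h1⟩
    · exact ⟨v, by simp, b, hmem b, h1⟩
    · exact ⟨a, hmem a, v, by simp, h1.symm⟩

theorem HasCompleteMinor.of_neighborSet {r : ℕ} {G : SimpleGraph V} {u : V}
    (h : HasCompleteMinor (r + 2) (G.restrictTo (G.neighborSet u))) :
    HasCompleteMinor (r + 3) G :=
  h.cone (restrictTo_le _ _) (fun hu => (support_restrictTo_subset _ _ hu).ne rfl)
    fun _ hv => support_restrictTo_subset _ _ hv

/-- Graphs on a subset of `V` of size `n ≥ k` without `K_{k+2}` minor have at most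
`k * n - k * (k + 1) / 2` edges. -/
def MaderBound (V : Type) (k : ℕ) : Prop :=
  ∀ (A : Set V) (G : SimpleGraph V), G.support ⊆ A → k ≤ A.ncard → ¬HasCompleteMinor (k + 2) G →
    2 * G.edgeSet.ncard + k * (k + 1) ≤ 2 * k * A.ncard

theorem maderBound_zero : MaderBound V 0 := by
  intro A G _ _ hG
  have : G.edgeSet = ∅ := by
    by_contra hne
    obtain ⟨e, he⟩ := Set.nonempty_iff_ne_empty.2 hne
    induction e with
    | h a b => exact hG (hasCompleteMinor_two he)
  simp [this]

variable [Fintype V]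

theorem sum_ncard_neighborSet (G : SimpleGraph V) :
    ∑ v, (G.neighborSet v).ncard = 2 * G.edgeSet.ncard := by
  classical
  rw [← coe_edgeFinset, Set.ncard_coe_finset, ← sum_degrees_eq_twice_card_edges]
  refine Finset.sum_congr rfl fun v _ => ?_
  rw [← card_neighborSet_eq_degree, Set.ncard_eq_toFinset_card', Set.toFinset_card]

theorem mul_ncard_le_two_mul_ncard_edgeSet {G : SimpleGraph V} {A : Set V} {m : ℕ}
    (h : ∀ v ∈ A, m ≤ (G.neighborSet v).ncard) : m * A.ncard ≤ 2 * G.edgeSet.ncard := by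
  classical
  rw [← sum_ncard_neighborSet, Set.ncard_eq_toFinset_card', mul_comm, ← smul_eq_mul,
    ← Finset.sum_const]
  exact (Finset.sum_le_sum fun v hv => h v (by simpa using hv)).trans
    (Finset.sum_le_univ_sum_of_nonneg fun _ => Nat.zero_le _)

theorem two_mul_ncard_edgeSet_le_mul_ncard {G : SimpleGraph V} {A : Set V} {m : ℕ}
    (hA : G.support ⊆ A) (h : ∀ v ∈ A, (G.neighborSet v).ncard ≤ m) :
    2 * G.edgeSet.ncard ≤ m * A.ncard := by
  classical
  rw [← sum_ncard_neighborSet, Set.ncard_eq_toFinset_card', mul_comm, ← smul_eq_mul,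
    ← Finset.sum_const, ← Finset.sum_subset (Finset.subset_univ A.toFinset)]
  · exact Finset.sum_le_sum fun v hv => h v (by simpa using hv)
  · intro v _ hv
    have : G.neighborSet v = ∅ := by
      by_contra hne
      obtain ⟨w, hw⟩ := Set.nonempty_iff_ne_empty.2 hne
      exact hv (by simpa using hA ⟨w, hw⟩)
    simp [this]

theorem ncard_edgeSet_deleteIncidenceSet_add (G : SimpleGraph V) (v : V) :
    (G.deleteIncidenceSet v).edgeSet.ncard + (G.neighborSet v).ncard = G.edgeSet.ncard := by
  classical
  have h1 := G.card_edgeFinset_deleteIncidenceSet v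
  have h2 := G.degree_le_card_edgeFinset v
  rw [← coe_edgeFinset, ← coe_edgeFinset, Set.ncard_coe_finset, Set.ncard_coe_finset,
    Set.ncard_eq_toFinset_card', Set.toFinset_card, card_neighborSet_eq_degree]
  omega

theorem ncard_edgeSet_sup_edge {G : SimpleGraph V} {x y : V} (hne : x ≠ y) (h : ¬G.Adj x y) :
    (G ⊔ edge x y).edgeSet.ncard = G.edgeSet.ncard + 1 := by
  rw [edgeSet_sup, edgeSet_edge_of_ne hne, Set.union_singleton,
    Set.ncard_insert_of_notMem (by simpa using h)]

theorem ncard_edgeSet_le_contractEdge (G : SimpleGraph V) (u v : V) :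
    G.edgeSet.ncard ≤ (G.contractEdge u v).edgeSet.ncard + 1 +
      (G.neighborSet u ∩ G.neighborSet v).ncard := by
  set T : Set V := G.neighborSet v \ insert u (G.neighborSet u) with hT
  have hinj : Function.Injective (fun b => s(u, b)) := fun b c hbc =>
    Sym2.congr_right.1 hbc
  have hsub : (G.deleteIncidenceSet v).edgeSet ∪ (fun b => s(u, b)) '' T ⊆
      (G.contractEdge u v).edgeSet := by
    apply Set.union_subset
    · exact edgeSet_mono le_sup_left
    · rintro _ ⟨b, ⟨hb, hbu⟩, rfl⟩
      simp only [Set.mem_insert_iff, not_or] at hbu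
      rw [mem_edgeSet, contractEdge_adj]
      exact Or.inr (Or.inl ⟨rfl, hb, hbu.1⟩)
  have hdisj : Disjoint (G.deleteIncidenceSet v).edgeSet ((fun b => s(u, b)) '' T) := by
    rw [Set.disjoint_left]
    rintro _ he ⟨b, ⟨-, hbu⟩, rfl⟩
    simp only [Set.mem_insert_iff, not_or] at hbu
    exact hbu.2 (deleteIncidenceSet_le G v he)
  have h1 := Set.ncard_le_ncard hsub
  rw [Set.ncard_union_eq hdisj, Set.ncard_image_of_injective _ hinj] at h1
  have h2 := G.ncard_edgeSet_deleteIncidenceSet_add v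
  have h3 : G.neighborSet v ⊆ T ∪ insert u (G.neighborSet u ∩ G.neighborSet v) := by
    intro b hb
    by_cases hbu : b ∈ insert u (G.neighborSet u)
    · rcases hbu with rfl | hbu
      · exact Or.inr (Or.inl rfl)
      · exact Or.inr (Or.inr ⟨hbu, hb⟩)
    · exact Or.inl ⟨hb, hbu⟩
  have h4 := Set.ncard_le_ncard h3
  have h5 := Set.ncard_union_le T (insert u (G.neighborSet u ∩ G.neighborSet v))
  have h6 := Set.ncard_insert_le u (G.neighborSet u ∩ G.neighborSet v)
  omega

theorem ncard_edgeSet_add_le_of_cover {G : SimpleGraph V} {A B : Set V}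
    (h : ∀ a b, G.Adj a b → (a ∈ A ∧ b ∈ A) ∨ (a ∈ B ∧ b ∈ B)) :
    G.edgeSet.ncard + (G.restrictTo (A ∩ B)).edgeSet.ncard ≤
      (G.restrictTo A).edgeSet.ncard + (G.restrictTo B).edgeSet.ncard := by
  rw [← Set.ncard_union_add_ncard_inter (G.restrictTo A).edgeSet]
  refine Nat.add_le_add (Set.ncard_le_ncard ?_) (Set.ncard_le_ncard ?_)
  · intro e
    induction e with
    | h a b => exact fun hab => (h a b hab).imp (fun h => ⟨hab, h⟩) (fun h => ⟨hab, h⟩)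
  · intro e
    induction e with
    | h a b =>
      exact fun hab => ⟨⟨hab.1, hab.2.1.1, hab.2.2.1⟩, ⟨hab.1, hab.2.1.2, hab.2.2.2⟩⟩

theorem ncard_edgeSet_le_add_restrictTo {G : SimpleGraph V} {u : V}
    (h : G.support ⊆ insert u (G.neighborSet u)) : G.edgeSet.ncard ≤
      (G.restrictTo (G.neighborSet u)).edgeSet.ncard + (G.neighborSet u).ncard := by
  rw [← G.ncard_edgeSet_deleteIncidenceSet_add u]
  refine Nat.add_le_add_right (Set.ncard_le_ncard (edgeSet_mono ?_)) _
  intro a b hab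
  rw [deleteIncidenceSet_adj] at hab
  exact ⟨hab.1, (h ⟨b, hab.1⟩).resolve_left hab.2.1, (h ⟨a, hab.1.symm⟩).resolve_left hab.2.2⟩

theorem le_two_mul_ncard_edgeSet_restrictTo {G : SimpleGraph V} {u : V} {k : ℕ}
    (h : ∀ v, G.Adj u v → k ≤ (G.neighborSet u ∩ G.neighborSet v).ncard) :
    k * (G.neighborSet u).ncard ≤ 2 * (G.restrictTo (G.neighborSet u)).edgeSet.ncard := by
  refine mul_ncard_le_two_mul_ncard_edgeSet fun v hv => ?_
  rw [neighborSet_restrictTo hv, Set.inter_comm]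
  exact h v hv

/-- Minimal counterexamples to `MaderBound V k` have large minimum degree and every edge
in at least `k` triangles. -/
theorem maderBound_of_extremal {k : ℕ}
    (h : ∀ (A : Set V) (G : SimpleGraph V), G.support ⊆ A → k < A.ncard →
      ¬HasCompleteMinor (k + 2) G → 2 * G.edgeSet.ncard + k * (k + 1) = 2 * k * A.ncard + 2 →
      (∀ u v, G.Adj u v → k ≤ (G.neighborSet u ∩ G.neighborSet v).ncard) →
      (∀ v ∈ A, k + 1 ≤ (G.neighborSet v).ncard) →
      (∀ (B : Set V) (G' : SimpleGraph V), G'.support ⊆ B → k ≤ B.ncard → B.ncard < A.ncard →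
        G' ≤ G → 2 * G'.edgeSet.ncard + k * (k + 1) ≤ 2 * k * B.ncard) → False) :
    MaderBound V k := by
  intro A
  induction hn : A.ncard using Nat.strong_induction_on generalizing A with
  | _ n ih =>
  subst hn
  intro G hGA hk hG
  by_contra! hlt
  obtain ⟨c, hc⟩ := (Nat.even_mul_succ_self k)
  have hdeg : ∀ v, (G.neighborSet v).ncard + 1 ≤ A.ncard ∨ v ∉ A := by
    intro v
    by_cases hv : v ∈ A
    · left
      have h1 : insert v (G.neighborSet v) ⊆ A :=
        Set.insert_subset hv fun w hw => hGA ⟨v, hw.symm⟩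
      have h2 := Set.ncard_le_ncard h1
      rwa [Set.ncard_insert_of_notMem (by simp)] at h2
    · exact Or.inr hv
  have hk' : k < A.ncard := by
    refine lt_of_le_of_ne hk fun hkA => ?_
    have := two_mul_ncard_edgeSet_le_mul_ncard (m := k - 1) hGA fun v hv => by
      have := hdeg v
      grind
    rw [← hkA] at this hlt
    rcases k with _ | k
    · omega
    · simp only [Nat.add_sub_cancel] at this
      nlinarith
  obtain ⟨G', hG'G, hG'⟩ := exists_le_ncard_edgeSet_eq (G := G)
    (m := k * A.ncard + 1 - c) (by rw [mul_assoc] at hlt; omega)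
  have hc' : c ≤ k * A.ncard := by nlinarith
  have hG'n : ¬HasCompleteMinor (k + 2) G' := fun hm => hG (hm.mono hG'G)
  have hG'A : G'.support ⊆ A := (support_mono hG'G).trans hGA
  have hex : 2 * G'.edgeSet.ncard + k * (k + 1) = 2 * k * A.ncard + 2 := by
    rw [mul_assoc]; omega
  refine h A G' hG'A hk' hG'n hex ?_ ?_ ?_
  · intro u v huv
    by_contra! ht
    have hv : v ∈ A := hG'A ⟨u, huv.symm⟩
    have h1 := Set.ncard_sdiff_singleton_add_one hv
    have h2 := ih _ (by omega) (A \ {v}) rfl (G'.contractEdge u v)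
      (support_contractEdge_subset huv hG'A) (by omega)
      (fun hm => hG'n (hm.of_contractEdge huv))
    have h3 := ncard_edgeSet_le_contractEdge G' u v
    rw [← h1] at hex
    nlinarith
  · intro v hv
    by_contra! ht
    have h1 := Set.ncard_sdiff_singleton_add_one hv
    have h2 := ih _ (by omega) (A \ {v}) rfl (G'.deleteIncidenceSet v)
      ((G'.support_deleteIncidenceSet_subset v).trans (Set.sdiff_subset_sdiff_left hG'A)) (by omega)
      (fun hm => hG'n (hm.mono (deleteIncidenceSet_le G' v)))
    have h3 := G'.ncard_edgeSet_deleteIncidenceSet_add v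
    rw [← h1] at hex
    nlinarith
  · exact fun B G'' hB hkB hBA hle => ih _ hBA B rfl G'' hB hkB fun hm => hG'n (hm.mono hle)

theorem exists_mem_ncard_neighborSet_lt {G : SimpleGraph V} {A : Set V} {m : ℕ}
    (h : 2 * G.edgeSet.ncard < m * A.ncard) : ∃ v ∈ A, (G.neighborSet v).ncard < m := by
  by_contra! hcon
  exact h.not_ge (mul_ncard_le_two_mul_ncard_edgeSet hcon)

theorem MaderBound.succ {k : ℕ} (hk : k < 3) (h : MaderBound V k) : MaderBound V (k + 1) := by
  refine maderBound_of_extremal fun A G hGA hkA hG hex htri hdeg _ => ?_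
  have hpos : 0 < A.ncard := by omega
  obtain ⟨u, huA, hu⟩ : ∃ u ∈ A, (G.neighborSet u).ncard < 2 * (k + 1) + (1 - k) := by
    apply exists_mem_ncard_neighborSet_lt
    interval_cases k <;> omega
  have h1 := hdeg u huA
  have h2 := le_two_mul_ncard_edgeSet_restrictTo (htri u)
  have h3 := h (G.neighborSet u) (G.restrictTo (G.neighborSet u))
    (support_restrictTo_subset _ _) (by omega) (fun hm => hG hm.of_neighborSet)
  interval_cases k <;> omega

theorem maderBound_three : MaderBound V 3 :=
  ((maderBound_zero.succ (by norm_num)).succ (by norm_num)).succ (by norm_num)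

end

section

variable {V : Type}

theorem ConnectedOn.pair {G : SimpleGraph V} {x y : V} (h : G.Adj x y) : G.ConnectedOn {x, y} :=
  (connectedOn_singleton G y).insert rfl h

theorem hasCompleteMinor_of_lt {r : ℕ} {G : SimpleGraph V} (f : Fin r → Set V)
    (hc : ∀ i, G.ConnectedOn (f i)) (hd : ∀ i j, i < j → Disjoint (f i) (f j))
    (ha : ∀ i j, i < j → ∃ x ∈ f i, ∃ y ∈ f j, G.Adj x y) : HasCompleteMinor r G := by
  refine ⟨f, hc, fun i j hij => ?_, fun i j hij => ?_⟩
  · rcases lt_or_gt_of_ne hij with h | h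
    · exact hd i j h
    · exact (hd j i h).symm
  · rcases lt_or_gt_of_ne hij with h | h
    · exact ha i j h
    · obtain ⟨x, hx, y, hy, hxy⟩ := ha j i h
      exact ⟨y, hy, x, hx, hxy.symm⟩

theorem hasCompleteMinor_five_of_adj {G : SimpleGraph V} {x y z r a b c : V}
    (hnodup : [x, y, z, r, a, b, c].Nodup) (hxy : G.Adj x y) (hzr : G.Adj z r)
    (hxz : G.Adj x z) (hxa : G.Adj x a ∨ G.Adj y a) (hxb : G.Adj x b ∨ G.Adj y b)
    (hxc : G.Adj x c ∨ G.Adj y c) (hza : G.Adj z a ∨ G.Adj r a) (hzb : G.Adj z b ∨ G.Adj r b)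
    (hzc : G.Adj z c ∨ G.Adj r c) (hab : G.Adj a b) (hac : G.Adj a c) (hbc : G.Adj b c) :
    HasCompleteMinor 5 G := by
  refine hasCompleteMinor_of_lt ![{x, y}, {z, r}, {a}, {b}, {c}] ?_ ?_ ?_
  · intro i
    fin_cases i
    exacts [.pair hxy, .pair hzr, connectedOn_singleton G a, connectedOn_singleton G b,
      connectedOn_singleton G c]
  · intro i j hij
    fin_cases i <;> fin_cases j <;> simp at hij hnodup ⊢ <;> grind
  · intro i j hij
    fin_cases i <;> fin_cases j <;> simp at hij ⊢ <;> grind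

/-- A 4-regular graph on seven vertices has a `K_5` minor. -/
theorem hasCompleteMinor_five_of_regular {G : SimpleGraph V} {N : Set V} (hN : N.ncard = 7)
    (hdeg : ∀ v ∈ N, (G.neighborSet v ∩ N).ncard = 4) : HasCompleteMinor 5 G := by
  have hfin : N.Finite := Set.finite_of_ncard_ne_zero (by omega)
  have hM : ∀ v ∈ N, ∃ p q, p ≠ q ∧ ∀ w, (w ∈ N ∧ w ≠ v ∧ ¬G.Adj v w) ↔ w = p ∨ w = q := by
    intro v hv
    have h1 : (N \ insert v (G.neighborSet v ∩ N)).ncard = 2 := by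
      have h2 := Set.ncard_sdiff_add_ncard_of_subset
        (Set.insert_subset hv (Set.inter_subset_right (s := G.neighborSet v))) hfin
      rw [Set.ncard_insert_of_notMem (by simp) (hfin.subset Set.inter_subset_right), hdeg v hv]
        at h2
      omega
    obtain ⟨p, q, hpq, h⟩ := Set.ncard_eq_two.1 h1
    refine ⟨p, q, hpq, fun w => ?_⟩
    have := Set.ext_iff.1 h w
    simp only [Set.mem_sdiff, Set.mem_insert_iff, Set.mem_inter_iff, mem_neighborSet,
      Set.mem_singleton_iff] at this
    grind
  have hout : ∀ l : List V, l.length < 7 → ∃ v ∈ N, v ∉ l := by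
    classical
    intro l hl
    by_contra! hcon
    have h1 := Set.ncard_le_ncard (t := (l.toFinset : Set V)) (fun v hv => by simpa using hcon v hv)
    rw [Set.ncard_coe_finset] at h1
    have := l.toFinset_card_le
    omega
  obtain ⟨x, hx, -⟩ := hout [] (by simp)
  obtain ⟨a, b, hab, hMx⟩ := hM x hx
  have ha := (hMx a).2 (Or.inl rfl)
  have hb := (hMx b).2 (Or.inr rfl)
  have hM' : ∀ v ∈ N, ∀ w, w ∈ N → w ≠ v → ¬G.Adj v w → ∃ w', ∀ e ∈ N, e ≠ v → ¬G.Adj v e →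
      e = w ∨ e = w' := by
    intro v hv w hw hwv hvw
    obtain ⟨p, q, -, h⟩ := hM v hv
    rcases (h w).1 ⟨hw, hwv, hvw⟩ with rfl | rfl
    · exact ⟨q, fun e he hev hve => (h e).1 ⟨he, hev, hve⟩⟩
    · exact ⟨p, fun e he hev hve => ((h e).1 ⟨he, hev, hve⟩).symm⟩
  have hthird : ∀ v ∈ N, ∀ w ∈ N, ∀ w' ∈ N, ∀ e ∈ N, w ≠ v → w' ≠ v → e ≠ v → w ≠ w' → e ≠ w →
      e ≠ w' → ¬G.Adj v w → ¬G.Adj v w' → G.Adj v e := by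
    intro v hv w hw w' hw' e he h1 h2 h3 h4 h5 h6 h7 h8
    by_contra h9
    obtain ⟨c, hc⟩ := hM' v hv w hw h1 h7
    rcases hc w' hw' h2 h8 with h | h
    · exact h4 h.symm
    · exact (hc e he h3 h9).elim h5 fun h' => h6 (h'.trans h.symm)
  obtain ⟨a', hMa⟩ := hM' a ha.1 x hx ha.2.1.symm fun h => ha.2.2 h.symm
  obtain ⟨b', hMb⟩ := hM' b hb.1 x hx hb.2.1.symm fun h => hb.2.2 h.symm
  obtain ⟨y, hy, hyl⟩ := hout [x, a, b, a', b'] (by simp)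
  simp only [List.mem_cons, List.not_mem_nil, or_false, not_or, ← ne_eq] at hyl
  have hya : G.Adj y a := by
    by_contra h
    have := hMa y hy hyl.2.1 fun h' => h h'.symm
    tauto
  have hyb : G.Adj y b := by
    by_contra h
    have := hMb y hy hyl.2.2.1 fun h' => h h'.symm
    tauto
  have hxy : G.Adj x y := by
    by_contra h
    have := (hMx y).1 ⟨hy, hyl.1, h⟩
    tauto
  obtain ⟨p, q, hpq, hMy⟩ := hM y hy
  have hp := (hMy p).2 (Or.inl rfl)
  have hq := (hMy q).2 (Or.inr rfl)
  obtain ⟨z, hz, hzl⟩ := hout [x, y, a, b, p, q] (by simp)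
  simp only [List.mem_cons, List.not_mem_nil, or_false, not_or, ← ne_eq] at hzl
  obtain ⟨hzx, hzy, hza, hzb, hzp, hzq⟩ := hzl
  have hxz : G.Adj x z := by
    by_contra h
    have := (hMx z).1 ⟨hz, hzx, h⟩
    tauto
  have hyz : G.Adj y z := by
    by_contra h
    have := (hMy z).1 ⟨hz, hzy, h⟩
    tauto
  have hpa : p ≠ a := fun h => hp.2.2 (h ▸ hya)
  have hpb : p ≠ b := fun h => hp.2.2 (h ▸ hyb)
  have hqa : q ≠ a := fun h => hq.2.2 (h ▸ hya)
  have hqb : q ≠ b := fun h => hq.2.2 (h ▸ hyb)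
  have hpx : p ≠ x := fun h => hp.2.2 (h ▸ hxy.symm)
  have hqx : q ≠ x := fun h => hq.2.2 (h ▸ hxy.symm)
  have hxp : G.Adj x p := by
    by_contra h
    have := (hMx p).1 ⟨hp.1, hpx, h⟩
    tauto
  have hxq : G.Adj x q := by
    by_contra h
    have := (hMx q).1 ⟨hq.1, hqx, h⟩
    tauto
  obtain ⟨s, t, hst, hMz⟩ := hM z hz
  have hs := (hMz s).2 (Or.inl rfl)
  have ht := (hMz t).2 (Or.inr rfl)
  obtain ⟨s₁, hs₁, hs₁l⟩ := hout [x, y, z, s, t] (by simp)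
  obtain ⟨s₂, hs₂, hs₂l⟩ := hout [x, y, z, s, t, s₁] (by simp)
  simp only [List.mem_cons, List.not_mem_nil, or_false, not_or, ← ne_eq] at hs₁l hs₂l
  have hall : ∀ w ∈ N, w ≠ x → w ≠ y → w ≠ z →
      (G.Adj x w ∨ G.Adj y w) ∧ (¬G.Adj x w ∨ ¬G.Adj y w) := by
    intro w hw hwx hwy hwz
    have hw4 : w = a ∨ w = b ∨ w = p ∨ w = q := by
      classical
      by_contra hcon
      have hnd : [w, x, y, z, a, b, p, q].Nodup := by
        simp only [List.nodup_cons, List.mem_cons, List.not_mem_nil, or_false, not_or]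
        rw [not_or, not_or, not_or] at hcon
        exact ⟨⟨hwx, hwy, hwz, hcon⟩,
          ⟨hyl.1.symm, hzx.symm, ha.2.1.symm, hb.2.1.symm, hpx.symm, hqx.symm⟩,
          ⟨hzy.symm, hyl.2.1, hyl.2.2.1, hp.2.1.symm, hq.2.1.symm⟩, ⟨hza, hzb, hzp, hzq⟩,
          ⟨hab, hpa.symm, hqa.symm⟩, ⟨hpb.symm, hqb.symm⟩, hpq, not_false, List.nodup_nil⟩
      have h1 := Set.ncard_le_ncard (s := ([w, x, y, z, a, b, p, q].toFinset : Set V)) (t := N)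
        (by
          intro v hv
          simp only [List.coe_toFinset, List.mem_cons, List.not_mem_nil, or_false,
            Set.mem_ofPred_eq] at hv
          rcases hv with rfl | rfl | rfl | rfl | rfl | rfl | rfl | rfl
          exacts [hw, hx, hy, hz, ha.1, hb.1, hp.1, hq.1]) hfin
      rw [Set.ncard_coe_finset, List.toFinset_card_of_nodup hnd, hN] at h1
      simp at h1
    rcases hw4 with rfl | rfl | rfl | rfl
    exacts [⟨Or.inr hya, Or.inl ha.2.2⟩, ⟨Or.inr hyb, Or.inl hb.2.2⟩,
      ⟨Or.inl hxp, Or.inr hp.2.2⟩, ⟨Or.inl hxq, Or.inr hq.2.2⟩]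
  have hadj : ∀ w ∈ N, w ≠ x → w ≠ y → w ≠ z → ¬G.Adj w z → ∀ e ∈ N, e ≠ x → e ≠ y → e ≠ z →
      e ≠ w → G.Adj w e := by
    intro w hw hwx hwy hwz hwz' e he hex hey hez hew
    rcases (hall w hw hwx hwy hwz).2 with h | h
    · exact hthird w hw z hz x hx e he hwz.symm hwx.symm hew hzx hez hex hwz' fun h' => h h'.symm
    · exact hthird w hw z hz y hy e he hwz.symm hwy.symm hew hzy hez hey hwz' fun h' => h h'.symm
  have hsx : s ≠ x := fun e => hs.2.2 (e ▸ hxz.symm)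
  have hsy : s ≠ y := fun e => hs.2.2 (e ▸ hyz.symm)
  have htx : t ≠ x := fun e => ht.2.2 (e ▸ hxz.symm)
  have hty : t ≠ y := fun e => ht.2.2 (e ▸ hyz.symm)
  have hzs₁ : G.Adj z s₁ := by
    by_contra h
    have := (hMz s₁).1 ⟨hs₁, hs₁l.2.2.1, h⟩
    tauto
  have hzs₂ : G.Adj z s₂ := by
    by_contra h
    have := (hMz s₂).1 ⟨hs₂, hs₂l.2.2.1, h⟩
    tauto
  have hs' := hadj s hs.1 hsx hsy hs.2.1 fun h => hs.2.2 h.symm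
  have ht' := hadj t ht.1 htx hty ht.2.1 fun h => ht.2.2 h.symm
  refine hasCompleteMinor_five_of_adj (x := x) (y := y) (z := z) (r := s₁) (a := s) (b := t)
    (c := s₂) ?_ hxy hzs₁ hxz (hall s hs.1 hsx hsy hs.2.1).1 (hall t ht.1 htx hty ht.2.1).1
    (hall s₂ hs₂ hs₂l.1 hs₂l.2.1 hs₂l.2.2.1).1 (Or.inr ?_) (Or.inr ?_) (Or.inl hzs₂) ?_ ?_ ?_
  · simp only [List.nodup_cons, List.mem_cons, List.not_mem_nil, or_false, not_or]
    exact ⟨⟨hyl.1.symm, hzx.symm, hs₁l.1.symm, hsx.symm, htx.symm, hs₂l.1.symm⟩,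
      ⟨hzy.symm, hs₁l.2.1.symm, hsy.symm, hty.symm, hs₂l.2.1.symm⟩,
      ⟨hs₁l.2.2.1.symm, hs.2.1.symm, ht.2.1.symm, hs₂l.2.2.1.symm⟩,
      ⟨hs₁l.2.2.2.1, hs₁l.2.2.2.2, hs₂l.2.2.2.2.2.symm⟩,
      ⟨hst, hs₂l.2.2.2.1.symm⟩, hs₂l.2.2.2.2.1.symm, not_false, List.nodup_nil⟩
  · exact (hs' s₁ hs₁ hs₁l.1 hs₁l.2.1 hs₁l.2.2.1 hs₁l.2.2.2.1).symm
  · exact (ht' s₁ hs₁ hs₁l.1 hs₁l.2.1 hs₁l.2.2.1 hs₁l.2.2.2.2).symm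
  · exact hs' t ht.1 htx hty ht.2.1 hst.symm
  · exact hs' s₂ hs₂ hs₂l.1 hs₂l.2.1 hs₂l.2.2.1 hs₂l.2.2.2.1
  · exact ht' s₂ hs₂ hs₂l.1 hs₂l.2.1 hs₂l.2.2.1 hs₂l.2.2.2.2.1

end

section

variable {V : Type}

variable [Fintype V]

theorem ncard_edgeSet_lt_of_ncard_eq_seven {G : SimpleGraph V} {N : Set V} (hG : G.support ⊆ N)
    (hN : N.ncard = 7) (hdeg : ∀ v ∈ N, 4 ≤ (G.neighborSet v).ncard)
    (hm : ¬HasCompleteMinor 5 G) : 14 < G.edgeSet.ncard := by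
  classical
  by_contra! hcon
  refine hm (hasCompleteMinor_five_of_regular hN fun v hv => ?_)
  rw [Set.inter_eq_left.2 fun w hw => hG ⟨v, hw.symm⟩]
  refine le_antisymm ?_ (hdeg v hv)
  by_contra! hlt
  have h1 : 4 * (N \ {v}).ncard ≤ ∑ w ∈ (N \ {v}).toFinite.toFinset, (G.neighborSet w).ncard := by
    rw [Set.ncard_eq_toFinset_card _, mul_comm, ← smul_eq_mul, ← Finset.sum_const]
    exact Finset.sum_le_sum fun w hw => hdeg w (by simp at hw; exact hw.1)
  have h2 : ∑ w ∈ insert v (N \ {v}).toFinite.toFinset, (G.neighborSet w).ncard ≤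
      2 * G.edgeSet.ncard := by
    rw [← sum_ncard_neighborSet]
    exact Finset.sum_le_univ_sum_of_nonneg fun _ => Nat.zero_le _
  rw [Finset.sum_insert (by simp)] at h2
  have h3 := Set.ncard_sdiff_singleton_add_one hv
  omega

/-- In the neighborhood of a vertex of degree at most 7 whose edges lie in four triangles, any
missing edge completes a `K_5` minor. -/
theorem hasCompleteMinor_five_sup_edge {G : SimpleGraph V} {u x y : V}
    (hG : ¬HasCompleteMinor 6 G) (hu : (G.neighborSet u).ncard ≤ 7)
    (htri : ∀ v, G.Adj u v → 4 ≤ (G.neighborSet u ∩ G.neighborSet v).ncard)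
    (hx : G.Adj u x) (hy : G.Adj u y) (hne : x ≠ y) (hxy : ¬G.Adj x y) :
    HasCompleteMinor 5 (G.restrictTo (G.neighborSet u) ⊔ edge x y) := by
  have hH : ¬HasCompleteMinor 5 (G.restrictTo (G.neighborSet u)) := fun h =>
    hG (HasCompleteMinor.of_neighborSet h)
  have hsupp := support_restrictTo_subset G (G.neighborSet u)
  have hsupp' : (G.restrictTo (G.neighborSet u) ⊔ edge x y).support ⊆ G.neighborSet u := by
    rintro a ⟨b, hab⟩
    rcases hab with hab | hab
    · exact hsupp ⟨b, hab⟩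
    · rw [edge_adj] at hab
      rcases hab.1 with ⟨rfl, rfl⟩ | ⟨rfl, rfl⟩
      exacts [hx, hy]
  have hdeg : ∀ v ∈ G.neighborSet u,
      4 ≤ ((G.restrictTo (G.neighborSet u)).neighborSet v).ncard := fun v hv => by
    rw [neighborSet_restrictTo hv, Set.inter_comm]
    exact htri v hv
  have h5 : 5 ≤ (G.neighborSet u).ncard := by
    have h1 := Set.ncard_le_ncard (s := insert x (G.neighborSet u ∩ G.neighborSet x))
      (t := G.neighborSet u) (Set.insert_subset hx Set.inter_subset_left)
    rw [Set.ncard_insert_of_notMem (by simp)] at h1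
    have := htri x hx
    omega
  have he := mul_ncard_le_two_mul_ncard_edgeSet hdeg
  have he' := ncard_edgeSet_sup_edge hne fun h => hxy (restrictTo_le G (G.neighborSet u) h)
  by_contra hm
  have hb := maderBound_three _ _ hsupp' (by omega) hm
  have h7 := fun h => ncard_edgeSet_lt_of_ncard_eq_seven hsupp h hdeg hH
  omega

theorem adj_of_connectedOn {G : SimpleGraph V} {u : V} (hG : ¬HasCompleteMinor 6 G)
    (hu : (G.neighborSet u).ncard ≤ 7)
    (htri : ∀ v, G.Adj u v → 4 ≤ (G.neighborSet u ∩ G.neighborSet v).ncard)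
    {C : Set V} (hC : G.ConnectedOn C) (hCu : Disjoint C (insert u (G.neighborSet u)))
    {x y : V} (hx : G.Adj u x) (hy : G.Adj u y) (hne : x ≠ y)
    (hxC : ∃ c ∈ C, G.Adj x c) (hyC : ∃ c ∈ C, G.Adj y c) : G.Adj x y := by
  classical
  by_contra hxy
  have hm := hasCompleteMinor_five_sup_edge hG hu htri hx hy hne hxy
  set H := G.restrictTo (G.neighborSet u) ⊔ edge x y with hH
  have hHu : ∀ v ∈ H.support, G.Adj u v := by
    rintro a ⟨b, hab⟩
    rcases hab with hab | hab
    · exact hab.2.1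
    · rw [edge_adj] at hab
      rcases hab.1 with ⟨rfl, rfl⟩ | ⟨rfl, rfl⟩
      exacts [hx, hy]
  have hm' : HasCompleteMinor 6 (H ⊔ G.restrictTo (insert u (G.neighborSet u))) :=
    HasCompleteMinor.cone hm le_sup_left (fun h => (hHu u h).ne rfl)
      fun v hv => Or.inr ⟨hHu v hv, Or.inl rfl, Or.inr (hHu v hv)⟩
  have hsupp : ∀ v ∈ (H ⊔ G.restrictTo (insert u (G.neighborSet u))).support, v ∉ C := by
    rintro v ⟨w, hvw⟩ hvC
    refine Set.disjoint_left.1 hCu hvC ?_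
    rcases hvw with h | h
    · exact Or.inr (hHu v ⟨w, h⟩)
    · exact h.2.1
  refine hG (hm'.trans (fun w => if w = x then insert x C else {w}) ?_ ?_ ?_)
  · intro v _
    split_ifs
    · obtain ⟨c, hc, hxc⟩ := hxC
      exact hC.insert hc hxc
    · exact connectedOn_singleton G v
  · intro v hv w hw hvw
    have h1 := hsupp v hv
    have h2 := hsupp w hw
    split_ifs with h3 h4 h4
    · exact absurd (h3.trans h4.symm) hvw
    · simpa [h2] using h4
    · simpa [h1] using h3
    · simpa using hvw
  · have hmem : ∀ w, w ∈ (if w = x then insert x C else {w} : Set V) := by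
      intro w
      split_ifs with h
      · exact Or.inl h
      · rfl
    have hsub : C ⊆ (if x = x then insert x C else {x} : Set V) := by
      rw [if_pos rfl]
      exact Set.subset_insert x C
    obtain ⟨c, hc, hyc⟩ := hyC
    rintro a b ((hab | hab) | hab)
    · exact ⟨a, hmem a, b, hmem b, hab.1⟩
    · rw [edge_adj] at hab
      rcases hab.1 with ⟨rfl, rfl⟩ | ⟨rfl, rfl⟩
      · exact ⟨c, hsub hc, b, hmem b, hyc.symm⟩
      · exact ⟨a, hmem a, c, hsub hc, hyc⟩
    · exact ⟨a, hmem a, b, hmem b, hab.1⟩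

theorem mul_ncard_sub_le_two_mul_ncard_edgeSet_restrictTo {G : SimpleGraph V} {S : Set V}
    (hS : ∀ x ∈ S, ∀ y ∈ S, x ≠ y → G.Adj x y) :
    (S.ncard - 1) * S.ncard ≤ 2 * (G.restrictTo S).edgeSet.ncard := by
  refine mul_ncard_le_two_mul_ncard_edgeSet fun v hv => ?_
  rw [neighborSet_restrictTo hv, ← Set.ncard_sdiff_singleton_of_mem hv]
  exact Set.ncard_le_ncard fun w hw => ⟨hS v hv w hw.1 (Ne.symm hw.2), hw.1⟩

/-- The set of vertices reachable from `w` while avoiding `N`. -/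
theorem exists_connectedOn_closed {G : SimpleGraph V} {N : Set V} {w : V} (hw : w ∉ N) :
    ∃ C, w ∈ C ∧ G.ConnectedOn C ∧ Disjoint C N ∧ ∀ a ∈ C, ∀ b, G.Adj a b → b ∉ N → b ∈ C := by
  obtain ⟨C, hC⟩ := (Set.toFinite {C : Set V | w ∈ C ∧ G.ConnectedOn C ∧ Disjoint C N}).exists_maximal
    ⟨{w}, rfl, connectedOn_singleton G w, by simpa using hw⟩
  refine ⟨C, hC.1.1, hC.1.2.1, hC.1.2.2, fun a ha b hab hb => ?_⟩
  exact hC.2 ⟨Or.inr hC.1.1, hC.1.2.1.insert ha hab.symm, by simp [hb, hC.1.2.2]⟩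
    (Set.subset_insert b C) (Or.inl rfl)

end

section

variable {V : Type}

theorem HasCompleteMinor.minorOf {r : ℕ} {G : SimpleGraph V} (h : HasCompleteMinor r G) :
    (⊤ : SimpleGraph (Fin r)).MinorOf G := by
  obtain ⟨f, hc, hd, ha⟩ := h
  exact ⟨f, fun i => (hc i).1, fun i => connected_induce_iff_connectedOn.2 (hc i), hd,
    fun i j hij => ha i j hij.ne⟩

theorem ConnectedComponent.connectedOn_image_supp {G : SimpleGraph V} {N : Set V}
    (C : (G.induce N).ConnectedComponent) : G.ConnectedOn (Subtype.val '' C.supp) := by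
  obtain ⟨c, hc⟩ := C.nonempty_supp
  refine ⟨⟨c, c, hc, rfl⟩, ?_⟩
  rintro A hA ⟨a, ha⟩ hcl _ ⟨b, hb, rfl⟩
  have key : ∀ x y : N, (G.induce N).Walk x y → x ∈ C.supp → (x : V) ∈ A → (y : V) ∈ A := by
    intro x y p
    induction p with
    | nil => exact fun _ => id
    | @cons x y _ hadj _ ih =>
      intro hx hxA
      have hy : y ∈ C.supp := (ConnectedComponent.mem_supp_congr_adj C hadj).1 hx
      exact ih hy (hcl x hxA y ⟨y, hy, rfl⟩ hadj)
  obtain ⟨a', ha', rfl⟩ := hA ha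
  obtain ⟨p⟩ := ConnectedComponent.exact (ha'.trans hb.symm)
  exact key a' b p ha' ha

variable [Fintype V]

theorem maderBound_four : MaderBound V 4 := by
  refine maderBound_of_extremal fun A G hGA hA hG hex htri hdeg ih => ?_
  obtain ⟨u, huA, hu⟩ := exists_mem_ncard_neighborSet_lt (G := G) (A := A) (m := 8) (by omega)
  have hu5 := hdeg u huA
  have hNA : insert u (G.neighborSet u) ⊆ A := Set.insert_subset huA fun v hv => hGA ⟨u, hv.symm⟩
  by_cases hAN : A ⊆ insert u (G.neighborSet u)
  · have h1 := ncard_edgeSet_le_add_restrictTo (hGA.trans hAN)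
    have hAc : A.ncard = (G.neighborSet u).ncard + 1 := by
      rw [hAN.antisymm hNA, Set.ncard_insert_of_notMem (by simp)]
    have h2 := maderBound_three (G.neighborSet u) _ (support_restrictTo_subset G _) (by omega)
      fun h => hG (HasCompleteMinor.of_neighborSet h)
    omega
  obtain ⟨w, hwA, hwN⟩ := Set.not_subset.1 hAN
  obtain ⟨C, hwC, hC, hCN, hcl⟩ := exists_connectedOn_closed (G := G) hwN
  set S : Set V := {s | G.Adj u s ∧ ∃ c ∈ C, G.Adj s c} with hS
  have hCnot : ∀ {c}, c ∈ C → c ∉ insert u (G.neighborSet u) := fun hc =>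
    Set.disjoint_left.1 hCN hc
  have hstep : ∀ a ∈ C, ∀ b, G.Adj a b → b ∈ C ∪ S := by
    intro a ha b hab
    by_cases hb : b ∈ insert u (G.neighborSet u)
    · rcases hb with rfl | hb
      · exact absurd (Or.inr hab.symm) (hCnot ha)
      · exact Or.inr ⟨hb, a, ha, hab.symm⟩
    · exact Or.inl (hcl a ha b hab hb)
  have hw5 := hdeg w hwA
  have hCA : C ⊆ A := by
    obtain ⟨x, hx⟩ := (Set.ncard_pos (Set.toFinite _)).1 ((Nat.succ_pos 4).trans_le hw5)
    exact (connectedOn_subset_support hC hwC ⟨x, hx⟩).trans hGA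
  have hSA : S ⊆ A := fun s hs => hNA (Or.inr hs.1)
  have hSC : Disjoint S C := Set.disjoint_left.2 fun s hs hsC => hCnot hsC (Or.inr hs.1)
  have hinter : (C ∪ S) ∩ (A \ C) = S := by
    ext v
    have h1 := @hSA v
    have h2 : v ∈ S → v ∉ C := fun h => Set.disjoint_left.1 hSC h
    simp only [Set.mem_inter_iff, Set.mem_union, Set.mem_sdiff]
    tauto
  have hunion : (C ∪ S) ∪ (A \ C) = A := by
    rw [Set.union_right_comm, Set.union_sdiff_cancel hCA, Set.union_eq_left.2 hSA]
  have hcard := Set.ncard_union_add_ncard_inter (C ∪ S) (A \ C)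
  rw [hinter, hunion] at hcard
  have hcover := ncard_edgeSet_add_le_of_cover (G := G) (A := C ∪ S) (B := A \ C) fun a b hab => by
    by_cases ha : a ∈ C
    · exact Or.inl ⟨Or.inl ha, hstep a ha b hab⟩
    by_cases hb : b ∈ C
    · exact Or.inl ⟨hstep b hb a hab.symm, Or.inl hb⟩
    exact Or.inr ⟨⟨hGA ⟨b, hab⟩, ha⟩, ⟨hGA ⟨a, hab.symm⟩, hb⟩⟩
  rw [hinter] at hcover
  have hclique : ∀ x ∈ S, ∀ y ∈ S, x ≠ y → G.Adj x y := fun x hx y hy hne =>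
    adj_of_connectedOn hG (by omega) (htri u) hC hCN hx.1 hy.1 hne hx.2 hy.2
  have heS := mul_ncard_sub_le_two_mul_ncard_edgeSet_restrictTo hclique
  have huCS : u ∉ C ∪ S := by
    rintro (h | h)
    · exact hCnot h (Or.inl rfl)
    · exact h.1.ne rfl
  have h1 := ih (C ∪ S) _ (support_restrictTo_subset G _)
    ((Nat.le_succ 4).trans (hw5.trans (Set.ncard_le_ncard fun b hb => hstep w hwC b hb)))
    (Set.ncard_lt_ncard ⟨Set.union_subset hCA hSA, fun h => huCS (h huA)⟩) (restrictTo_le _ _)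
  have h2 := ih (A \ C) _ (support_restrictTo_subset G _)
    ((Nat.le_succ 4).trans (hu5.trans (Set.ncard_le_ncard fun b hb =>
      ⟨hNA (Or.inr hb), fun h => hCnot h (Or.inr hb)⟩)))
    (Set.ncard_lt_ncard ⟨Set.sdiff_subset, fun h => (h hwA).2 hwC⟩) (restrictTo_le _ _)
  generalize S.ncard = s at *
  cases s with
  | zero => omega
  | succ t =>
    rw [Nat.add_sub_cancel] at heS
    zify at *
    nlinarith [sq_nonneg (2 * (t : ℤ) - 7)]

/-- A connected set `C` avoiding `N[u]`, all of whose neighbors lie in `C ∪ N(u)`, contains a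
vertex of degree at most 7. -/
theorem exists_mem_ncard_neighborSet_le_seven {G : SimpleGraph V} {u : V} {C : Set V}
    (hG : ¬HasCompleteMinor 6 G) (hu : (G.neighborSet u).ncard ≤ 7)
    (htri : ∀ v, G.Adj u v → 4 ≤ (G.neighborSet u ∩ G.neighborSet v).ncard)
    (hC : G.ConnectedOn C) (hCu : Disjoint C (insert u (G.neighborSet u)))
    (hcl : ∀ a ∈ C, ∀ b, G.Adj a b → b ∉ insert u (G.neighborSet u) → b ∈ C) :
    ∃ v ∈ C, (G.neighborSet v).ncard ≤ 7 := by
  by_contra! hcon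
  set S : Set V := {s | G.Adj u s ∧ ∃ c ∈ C, G.Adj s c} with hS
  have hstep : ∀ a ∈ C, ∀ b, G.Adj a b → b ∈ C ∪ S := by
    intro a ha b hab
    by_cases hb : b ∈ insert u (G.neighborSet u)
    · rcases hb with rfl | hb
      · exact absurd (Or.inr hab.symm) (Set.disjoint_left.1 hCu ha)
      · exact Or.inr ⟨hb, a, ha, hab.symm⟩
    · exact Or.inl (hcl a ha b hab hb)
  have hSC : Disjoint C S := Set.disjoint_left.2 fun s hsC hs =>
    Set.disjoint_left.1 hCu hsC (Or.inr hs.1)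
  have hdegC : ∀ v ∈ C, 8 ≤ ((G.restrictTo (C ∪ S)).neighborSet v).ncard := fun v hv => by
    rw [neighborSet_restrictTo (Set.mem_union_left S hv),
      Set.inter_eq_left.2 (show G.neighborSet v ⊆ C ∪ S from fun b hb => hstep v hv b hb)]
    exact hcon v hv
  have hdegS : ∀ v ∈ S, S.ncard ≤ ((G.restrictTo (C ∪ S)).neighborSet v).ncard := by
    intro v hv
    obtain ⟨c, hc, hvc⟩ := hv.2
    rw [neighborSet_restrictTo (Set.mem_union_right C hv), ← Set.ncard_sdiff_singleton_add_one hv,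
      ← Set.ncard_insert_of_notMem (a := c) fun h => Set.disjoint_left.1 hSC hc h.1]
    refine Set.ncard_le_ncard (Set.insert_subset ⟨hvc, Or.inl hc⟩ fun w hw => ⟨?_, Or.inr hw.1⟩)
    exact adj_of_connectedOn hG hu htri hC hCu hv.1 hw.1.1 (Ne.symm hw.2) hv.2 hw.1.2
  have hsum : 8 * C.ncard + S.ncard * S.ncard ≤ 2 * (G.restrictTo (C ∪ S)).edgeSet.ncard := by
    classical
    rw [← sum_ncard_neighborSet, Set.ncard_eq_toFinset_card' C, mul_comm 8, ← smul_eq_mul,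
      ← Finset.sum_const]
    nth_rw 1 [Set.ncard_eq_toFinset_card' S]
    rw [← smul_eq_mul (a := S.toFinset.card), ← Finset.sum_const]
    refine (Nat.add_le_add (Finset.sum_le_sum fun v hv => hdegC v (by simpa using hv))
      (Finset.sum_le_sum fun v hv => hdegS v (by simpa using hv))).trans ?_
    rw [← Finset.sum_union (Set.disjoint_toFinset.2 hSC)]
    exact Finset.sum_le_univ_sum_of_nonneg fun _ => Nat.zero_le _
  obtain ⟨c, hc⟩ := hC.1
  have h4 : 4 ≤ (C ∪ S).ncard := by
    have := Set.ncard_le_ncard (s := G.neighborSet c) (t := C ∪ S) fun b hb => hstep c hc b hb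
    have := hcon c hc
    omega
  have hb := maderBound_four _ _ (support_restrictTo_subset G (C ∪ S)) h4
    fun h => hG (h.mono (restrictTo_le _ _))
  rw [Set.ncard_union_eq hSC] at hb
  zify at *
  nlinarith [sq_nonneg ((S.ncard : ℤ) - 4)]

end

end SimpleGraph

/-- Let `G` be a finite simple graph with at least one edge, no `K_6`-minor,
such that every edge incident to a vertex of degree at most 7 belongs to at
least 4 triangles.  Then for every vertex `u` of degree at most 7 and every
connected component `C` of the induced subgraph `G \ N[u]`, some vertex of `C`
has degree at most 7 in `G`. -/
theorem statement15 {V : Type} [Fintype V] (G : SimpleGraph V) [DecidableRel G.Adj]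
    (hedge : G.edgeSet.Nonempty)
    (hfree : ¬ (⊤ : SimpleGraph (Fin 6)).MinorOf G)
    (htri : ∀ u v : V, G.Adj u v → G.degree u ≤ 7 →
      4 ≤ (G.neighborSet u ∩ G.neighborSet v).ncard) :
    ∀ u : V, G.degree u ≤ 7 →
      ∀ C : (G.induce ((insert u (G.neighborSet u))ᶜ : Set V)).ConnectedComponent,
        ∃ v : ((insert u (G.neighborSet u))ᶜ : Set V),
          (G.induce ((insert u (G.neighborSet u))ᶜ : Set V)).connectedComponentMk v = C ∧
          G.degree (v : V) ≤ 7 := by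
  have hd : ∀ v, (G.neighborSet v).ncard = G.degree v := fun v => by
    rw [Set.ncard_eq_toFinset_card', Set.toFinset_card, card_neighborSet_eq_degree]
  intro u hu C
  obtain ⟨_, ⟨v, hv, rfl⟩, hv7⟩ := exists_mem_ncard_neighborSet_le_seven (u := u)
    (fun h => hfree h.minorOf) ((hd u).trans_le hu) (fun v huv => htri u v huv hu)
    C.connectedOn_image_supp (Set.disjoint_left.2 (by rintro _ ⟨a, -, rfl⟩; exact a.2)) (by
      rintro _ ⟨a, ha, rfl⟩ b hab hb
      exact ⟨⟨b, hb⟩, (ConnectedComponent.mem_supp_congr_adj C (by exact hab)).1 ha, rfl⟩)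
  exact ⟨v, hv, (hd v).symm.trans_le hv7⟩
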